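/- arXiv:2407.20488 — 7 statements merged into one kernel-verified Lean document; each statement's English description precedes it below -/
import Mathlib

section
/- Let R be a ring, let μ be a module measure on the category of left R-modules, and let M be a minimally μ-big left R-module. Then every nonzero left R-module homomorphism from M to M is surjective. -/
universe u

/-- A **module measure** on the category of left `R`-modules: a `{0,1}`-valued function
(`false` standing for `0` and `true` for `1`) on all left `R`-modules such that
(1) the zero module has measure `0`; (2) isomorphic modules have equal measures;
(3) if `μ(M) = 1` and `N ≤ M` has `μ(N) = 0`, then `μ(M/N) = 1`. -/
structure ModuleMeasure (R : Type u) [Ring R] where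
  toFun : (M : Type u) → [AddCommGroup M] → [Module R M] → Bool
  measure_zero : ∀ (M : Type u) [AddCommGroup M] [Module R M],
    Subsingleton M → toFun M = false
  measure_iso : ∀ (M₁ : Type u) [AddCommGroup M₁] [Module R M₁]
    (M₂ : Type u) [AddCommGroup M₂] [Module R M₂],
    Nonempty (M₁ ≃ₗ[R] M₂) → toFun M₁ = toFun M₂
  measure_quot : ∀ (M : Type u) [AddCommGroup M] [Module R M] (N : Submodule R M),
    toFun M = true → toFun ↥N = false → toFun (M ⧸ N) = true

/-- A left `R`-module `M` is **minimally `μ`-big** if `μ(M) = 1` but `μ(N) = 0` for every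
proper submodule `N < M`. -/
def MinimallyMuBig {R : Type u} [Ring R] (μ : ModuleMeasure R)
    (M : Type u) [AddCommGroup M] [Module R M] : Prop :=
  μ.toFun M = true ∧ ∀ N : Submodule R M, N < ⊤ → μ.toFun ↥N = false


/-- **Lemma 3(2).** Let `R` be a ring, `μ` a module measure on `R`-mod, and `M` a minimally
`μ`-big left `R`-module. Then every nonzero left `R`-module homomorphism `M → M` is
surjective. -/
theorem minimallyMuBig_surjective_of_ne_zero {R : Type u} [Ring R] (μ : ModuleMeasure R)
    (M : Type u) [AddCommGroup M] [Module R M] (hM : MinimallyMuBig μ M) :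
    ∀ φ : M →ₗ[R] M, φ ≠ 0 → Function.Surjective φ := by
  intro φ hφ
  by_contra hs
  have hker : φ.ker < ⊤ := lt_top_iff_ne_top.2 fun h => hφ (LinearMap.ker_eq_top.1 h)
  have hran : φ.range < ⊤ := lt_top_iff_ne_top.2 fun h => hs (LinearMap.range_eq_top.1 h)
  have h1 := μ.measure_quot M φ.ker hM.1 (hM.2 _ hker)
  rw [μ.measure_iso _ _ ⟨φ.quotKerEquivRange⟩, hM.2 _ hran] at h1
  exact Bool.false_ne_true h1
end

section
/- Let R be a commutative ring, let M be an Artinian R-module, and let N be a cyclic submodule of M. Then there exist finitely many maximal ideals J₁, …, J_k of R such that J₁J₂⋯J_k N = {0}. -/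
/-- **Step (1) in the proof of Lemma 5 (Sharp).** Let `R` be a commutative ring, `M` an
Artinian `R`-module, and `N` a cyclic submodule of `M`. Then there exist finitely many
maximal ideals `J₁, …, J_k` of `R` such that `J₁J₂⋯J_k • N = 0`. -/
theorem cyclic_submodule_prod_maximal_smul_eq_bot
    (R : Type*) [CommRing R] (M : Type*) [AddCommGroup M] [Module R M]
    [IsArtinian R M] (N : Submodule R M) (hN : ∃ x : M, N = Submodule.span R {x}) :
    ∃ (k : ℕ) (J : Fin k → Ideal R), (∀ i, (J i).IsMaximal) ∧
      (∏ i, J i) • N = (⊥ : Submodule R M) := by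
  obtain ⟨x, rfl⟩ := hN
  set I : Ideal R := LinearMap.ker (LinearMap.toSpanSingleton R M x) with hI
  have h1 : IsArtinian R (R ⧸ I) :=
    isArtinian_of_injective (I.liftQ (LinearMap.toSpanSingleton R M x) le_rfl)
      (LinearMap.ker_eq_bot.mp (Submodule.ker_liftQ_eq_bot _ _ _ le_rfl))
  have h2 : IsArtinianRing (R ⧸ I) := isArtinian_of_tower R h1
  obtain ⟨Z, hZ⟩ := PrimeSpectrum.exists_primeSpectrum_prod_le (R ⧸ I) (⊥ : Ideal (R ⧸ I))
  obtain ⟨l, rfl⟩ := Quot.exists_rep Z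
  refine ⟨l.length, fun i => (l.get i).asIdeal.comap (Ideal.Quotient.mk I), fun i => ?_, ?_⟩
  · have : (l.get i).asIdeal.IsMaximal := inferInstance
    exact Ideal.comap_isMaximal_of_surjective _ Ideal.Quotient.mk_surjective
  · have key : ∏ i : Fin l.length, (l.get i).asIdeal.comap (Ideal.Quotient.mk I) ≤ I := by
      have h3 : (∏ i : Fin l.length,
          (l.get i).asIdeal.comap (Ideal.Quotient.mk I)).map (Ideal.Quotient.mk I) ≤ ⊥ := by
        refine le_trans ?_ hZ
        have h4 : (Multiset.map PrimeSpectrum.asIdeal (Quot.mk _ l)).prod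
            = ∏ i : Fin l.length, (l.get i).asIdeal := by
          change (List.map PrimeSpectrum.asIdeal l).prod = _
          simp
        rw [h4]
        change Ideal.mapHom (Ideal.Quotient.mk I) _ ≤ _
        rw [map_prod]
        exact Finset.prod_le_prod' fun i _ => Ideal.map_comap_le
      rw [Ideal.map_le_iff_le_comap] at h3
      refine h3.trans ?_
      intro r hr
      simpa [Ideal.mem_comap, Ideal.Quotient.eq_zero_iff_mem] using hr
    rw [eq_bot_iff, Submodule.smul_le]
    intro r hr n hn
    obtain ⟨a, rfl⟩ := Submodule.mem_span_singleton.mp hn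
    have h5 : r • x = 0 := by simpa [hI] using key hr
    rw [smul_comm, h5, smul_zero]
    exact Submodule.zero_mem _
end

section
/- Let R be a commutative ring and let M be an Artinian R-module. For each maximal ideal J of R, let M[J] := {m ∈ M : Jⁿm = {0} for some positive integer n}. Then the family of submodules (M[J]), as J ranges over the maximal ideals of R, is independent; that is, the sum of the M[J] over all maximal ideals J is a direct sum. -/
universe u

/-- For a maximal (or arbitrary) ideal `J` of `R`, the submodule
`M[J] = {m ∈ M : Jⁿ m = 0 for some n ∈ ℤ⁺}` of a module `M`. -/
def primaryComponent (R : Type u) [CommRing R] (M : Type u) [AddCommGroup M] [Module R M]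
    (J : Ideal R) : Submodule R M :=
  ⨆ n : ℕ+, Submodule.torsionBySet R M ((J ^ (n : ℕ) : Ideal R) : Set R)

/-- Elements killed by some ideal coprime to `J`. -/
def coprimeKilled (R : Type u) [CommRing R] (M : Type u) [AddCommGroup M] [Module R M]
    (J : Ideal R) : Submodule R M where
  carrier := {x | ∃ K : Ideal R, IsCoprime J K ∧ ∀ a ∈ K, a • x = 0}
  zero_mem' := by
    refine ⟨⊤, ?_, fun a _ => smul_zero a⟩
    rw [Ideal.isCoprime_iff_sup_eq, sup_top_eq]
  add_mem' := by
    rintro x y ⟨K, hK, hx⟩ ⟨L, hL, hy⟩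
    have hKL : IsCoprime J (K * L) := IsCoprime.mul_right hK hL
    refine ⟨K * L, hKL, fun a ha => ?_⟩
    have haK : a ∈ K := (Ideal.mul_le_left : K * L ≤ K) ha
    have haL : a ∈ L := (Ideal.mul_le_right : K * L ≤ L) ha
    have h1 : a • x = 0 := hx a haK
    have h2 : a • y = 0 := hy a haL
    rw [smul_add, h1, h2, add_zero]
  smul_mem' := by
    rintro c x ⟨K, hK, hx⟩
    exact ⟨K, hK, fun a ha => by rw [smul_comm, hx a ha, smul_zero]⟩

/-- **Part of Lemma 5 (Sharp).** Let `R` be a commutative ring and `M` an Artinian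
`R`-module. Then the family of submodules `M[J]`, as `J` ranges over the maximal ideals of
`R`, is independent: the sum of the `M[J]` is direct. -/
theorem primaryComponent_independent
    (R : Type u) [CommRing R] (M : Type u) [AddCommGroup M] [Module R M]
    [IsArtinian R M] :
    iSupIndep (fun J : {J : Ideal R // J.IsMaximal} => primaryComponent R M J.1) := by
  rintro ⟨J, hJ⟩
  rw [Submodule.disjoint_def]
  intro x hx hx'
  have hle : (⨆ (j : {J : Ideal R // J.IsMaximal}) (_ : j ≠ ⟨J, hJ⟩), primaryComponent R M j.1)
      ≤ coprimeKilled R M J := by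
    refine iSup_le fun ⟨I, hI⟩ => iSup_le fun hne => iSup_le fun n => ?_
    intro y hy
    refine ⟨I ^ (n : ℕ), ?_, fun a ha => ?_⟩
    · refine IsCoprime.pow_right (Ideal.isCoprime_of_isMaximal fun h => hne ?_)
      exact Subtype.ext h.symm
    · exact (Submodule.mem_torsionBySet_iff _ _).mp hy ⟨a, ha⟩
  obtain ⟨K, hK, hKx⟩ := hle hx'
  have hdir : Directed (· ≤ ·)
      (fun n : ℕ+ => Submodule.torsionBySet R M ((J ^ (n : ℕ) : Ideal R) : Set R)) := by
    refine Monotone.directed_le fun m n hmn => ?_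
    exact Submodule.torsionBySet_le_torsionBySet_of_subset (Ideal.pow_le_pow_right hmn)
  obtain ⟨n, hn⟩ := (Submodule.mem_iSup_of_directed _ hdir).mp hx
  obtain ⟨a, ha, b, hb, hab⟩ := Ideal.isCoprime_iff_exists.mp (hK.pow_left (m := (n : ℕ)))
  have h1 : a • x = 0 := (Submodule.mem_torsionBySet_iff _ _).mp hn ⟨a, ha⟩
  rw [← one_smul R x, ← hab, add_smul, h1, hKx b hb, add_zero]
end

section
/- Let R be a commutative ring and let M be an Artinian R-module. For each maximal ideal J of R, let M[J] := {m ∈ M : Jⁿm = {0} for some positive integer n}. Then there exist finitely many maximal ideals J₁, …, J_n of R such that M is the internal direct sum M[J₁] ⊕ ⋯ ⊕ M[J_n]. -/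
universe u

theorem mem_primaryComponent_iff_aux {R : Type u} [CommRing R] {M : Type u} [AddCommGroup M]
    [Module R M] {J : Ideal R} {x : M} :
    x ∈ primaryComponent R M J ↔
      ∃ n : ℕ, x ∈ Submodule.torsionBySet R M ((J ^ n : Ideal R) : Set R) := by
  unfold primaryComponent
  rw [Submodule.mem_iSup_of_directed]
  · constructor
    · rintro ⟨n, hn⟩
      exact ⟨n, hn⟩
    · rintro ⟨n, hn⟩
      exact ⟨⟨n + 1, n.succ_pos⟩,
        Submodule.torsionBySet_le_torsionBySet_pow _ _ (Nat.le_succ n) _ hn⟩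
  · apply Monotone.directed_le
    intro a b hab
    exact Submodule.torsionBySet_le_torsionBySet_pow _ _ hab _

theorem iSupIndep_primaryComponent_aux (R : Type u) [CommRing R] (M : Type u) [AddCommGroup M]
    [Module R M] :
    iSupIndep fun P : MaximalSpectrum R => primaryComponent R M P.asIdeal := by
  rw [iSupIndep_iff_finsetSum_eq_zero_imp_eq_zero]
  intro s p hmem hsum
  simp only [mem_primaryComponent_iff_aux] at hmem
  choose! f hmem using hmem
  let m := s.sup f
  have hSupIndep : iSupIndep fun i : MaximalSpectrum R ↦
      Submodule.torsionBySet R M ((i.asIdeal ^ m : Ideal R) : Set R) := by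
    rw [iSupIndep_iff_supIndep]
    exact fun _ ↦ Submodule.supIndep_torsionBySet_ideal
      fun _ _ _ _ hPQ ↦ Ideal.pow_sup_pow_eq_top (MaximalSpectrum.isCoprime_of_ne hPQ).sup_eq
  rw [iSupIndep_iff_finsetSum_eq_zero_imp_eq_zero] at hSupIndep
  apply hSupIndep _ _ ?_ hsum
  exact fun P hP ↦ Submodule.torsionBySet_le_torsionBySet_pow _ _ (Finset.le_sup hP) _ (hmem P hP)

theorem iSup_primaryComponent_aux (R : Type u) [CommRing R] (M : Type u) [AddCommGroup M]
    [Module R M] [IsArtinian R M] :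
    ⨆ P : MaximalSpectrum R, primaryComponent R M P.asIdeal = ⊤ := by
  classical
  rw [eq_top_iff]
  intro x _
  let I := Ideal.torsionOf R M x
  have h1 : IsArtinian R (R ⧸ I) :=
    isArtinian_of_linearEquiv (Ideal.quotTorsionOfEquivSpanSingleton R M x).symm
  have h2 : IsArtinianRing (R ⧸ I) := isArtinian_of_tower R h1
  obtain ⟨n, hn⟩ := IsArtinianRing.isNilpotent_nilradical (R := R ⧸ I)
  rw [IsArtinianRing.nilradical_pow_eq_iInf] at hn
  have : Fintype (MaximalSpectrum (R ⧸ I)) := Fintype.ofFinite _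
  have hsurj : Function.Surjective (Ideal.Quotient.mk I) := Ideal.Quotient.mk_surjective
  let c : MaximalSpectrum (R ⧸ I) → MaximalSpectrum R := fun Q =>
    ⟨Q.asIdeal.comap (Ideal.Quotient.mk I),
      haveI := Q.isMaximal; Ideal.comap_isMaximal_of_surjective _ hsurj⟩
  have hc : Function.Injective c := by
    intro P Q h
    ext1
    exact Ideal.comap_injective_of_surjective _ hsurj (congrArg MaximalSpectrum.asIdeal h)
  have hpw : ((Finset.univ : Finset (MaximalSpectrum (R ⧸ I))) : Set _).Pairwise
      fun i j => (c i).asIdeal ^ n ⊔ (c j).asIdeal ^ n = ⊤ := fun i _ j _ hij =>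
    Ideal.pow_sup_pow_eq_top (MaximalSpectrum.isCoprime_of_ne (hc.ne hij)).sup_eq
  have key := Submodule.iSup_torsionBySet_ideal_eq_torsionBySet_iInf (M := M) hpw
  have hx : x ∈ Submodule.torsionBySet R M
      ((⨅ i ∈ (Finset.univ : Finset (MaximalSpectrum (R ⧸ I))), (c i).asIdeal ^ n : Ideal R) :
        Set R) := by
    rw [Submodule.mem_torsionBySet_iff]
    rintro ⟨a, ha⟩
    have ha' : Ideal.Quotient.mk I a ∈ ⨅ Q : MaximalSpectrum (R ⧸ I), Q.asIdeal ^ n := by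
      rw [Ideal.mem_iInf]
      intro Q
      have h3 : a ∈ (c Q).asIdeal ^ n := by
        simp only [SetLike.mem_coe, Ideal.mem_iInf] at ha
        exact ha Q (Finset.mem_univ _)
      exact Ideal.le_comap_pow (Ideal.Quotient.mk I) n h3
    rw [hn] at ha'
    exact Ideal.Quotient.eq_zero_iff_mem.mp ha'
  rw [← key] at hx
  revert hx
  apply SetLike.le_def.mp
  refine iSup₂_le fun i _ => ?_
  refine le_trans ?_ (le_iSup (fun P : MaximalSpectrum R => primaryComponent R M P.asIdeal) (c i))
  intro y hy
  exact mem_primaryComponent_iff_aux.mpr ⟨n, hy⟩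

/-- **Lemma 5 (Sharp).** Let `R` be a commutative ring and `M` an Artinian `R`-module.
Then there exist finitely many maximal ideals `J₁, …, J_n` of `R` such that `M` is the
internal direct sum `M[J₁] ⊕ ⋯ ⊕ M[J_n]`: the submodules `M[Jᵢ]` are independent and
their sum is all of `M`. -/
theorem exists_finset_maximal_directSum_primaryComponent
    (R : Type u) [CommRing R] (M : Type u) [AddCommGroup M] [Module R M]
    [IsArtinian R M] :
    ∃ s : Finset (Ideal R), (∀ J ∈ s, J.IsMaximal) ∧
      iSupIndep (fun J : s => primaryComponent R M (J : Ideal R)) ∧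
      (⨆ J ∈ s, primaryComponent R M J) = ⊤ := by
  classical
  have hind := iSupIndep_primaryComponent_aux R M
  have hfin : {P : MaximalSpectrum R | primaryComponent R M P.asIdeal ≠ ⊥}.Finite :=
    WellFoundedLT.finite_ne_bot_of_iSupIndep hind
  refine ⟨hfin.toFinset.image MaximalSpectrum.asIdeal, ?_, ?_, ?_⟩
  · intro J hJ
    obtain ⟨P, _, rfl⟩ := Finset.mem_image.mp hJ
    exact P.isMaximal
  · have hm : ∀ J ∈ hfin.toFinset.image MaximalSpectrum.asIdeal, J.IsMaximal := by
      intro J hJ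
      obtain ⟨P, _, rfl⟩ := Finset.mem_image.mp hJ
      exact P.isMaximal
    exact hind.comp (f := fun J : hfin.toFinset.image MaximalSpectrum.asIdeal =>
      (⟨J.1, hm J.1 J.2⟩ : MaximalSpectrum R))
      (fun a b h => Subtype.ext (congrArg MaximalSpectrum.asIdeal h))
  · rw [eq_top_iff, ← iSup_primaryComponent_aux R M]
    refine iSup_le fun P => ?_
    by_cases hP : primaryComponent R M P.asIdeal = ⊥
    · rw [hP]
      exact bot_le
    · exact le_iSup₂_of_le P.asIdeal
        (Finset.mem_image_of_mem _ (hfin.mem_toFinset.mpr hP)) le_rfl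
end

section
/- Let R be a commutative ring. Then every Artinian R-module is countably generated; that is, every Artinian R-module has a countable generating set. -/
/-- The sum of the simple submodules. -/
def socAux (R : Type*) [CommRing R] (M : Type*) [AddCommGroup M] [Module R M] :
    Submodule R M :=
  ⨆ m ∈ {m : Submodule R M | IsSimpleModule R m}, m

theorem socAux_fg (R : Type*) [CommRing R] (M : Type*) [AddCommGroup M] [Module R M]
    [IsArtinian R M] : (socAux R M).FG := by
  have h : IsSemisimpleModule R (socAux R M) := by
    unfold socAux
    apply isSemisimpleModule_biSup_of_isSemisimpleModule_submodule
    intro m hm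
    have : IsSimpleModule R m := hm
    infer_instance
  have : IsArtinian R (socAux R M) := inferInstance
  exact Module.Finite.iff_fg.mp
    (((IsSemisimpleModule.finite_tfae (R := R) (M := socAux R M)).out 2 0).mp this)

/-- The socle series. -/
def socSeries (R : Type*) [CommRing R] (M : Type*) [AddCommGroup M] [Module R M] :
    ℕ → Submodule R M
  | 0 => ⊥
  | n + 1 => (socAux R (M ⧸ socSeries R M n)).comap (socSeries R M n).mkQ

theorem socSeries_le_succ (R : Type*) [CommRing R] (M : Type*) [AddCommGroup M] [Module R M]
    (n : ℕ) : socSeries R M n ≤ socSeries R M (n + 1) := by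
  intro x hx
  have : (socSeries R M n).mkQ x = 0 := by simpa using hx
  simp only [socSeries, Submodule.mem_comap]
  rw [this]
  exact zero_mem _

theorem socSeries_fg (R : Type*) [CommRing R] (M : Type*) [AddCommGroup M] [Module R M]
    [IsArtinian R M] (n : ℕ) : (socSeries R M n).FG := by
  induction n with
  | zero => exact Submodule.fg_bot
  | succ n ih =>
    apply Submodule.fg_of_fg_map_of_fg_inf_ker (socSeries R M n).mkQ
    · rw [socSeries, Submodule.map_comap_eq_of_surjective (Submodule.mkQ_surjective _)]
      exact socAux_fg R _
    · rw [Submodule.ker_mkQ, inf_eq_right.mpr (socSeries_le_succ R M n)]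
      exact ih

theorem exists_mem_socSeries (R : Type*) [CommRing R] (M : Type*) [AddCommGroup M] [Module R M]
    [IsArtinian R M] (x : M) : ∃ n, x ∈ socSeries R M n := by
  have hN : IsNoetherian R (Submodule.span R {x}) := isNoetherian_of_finite_isArtinian _
  have hmono : Monotone (socSeries R M) := monotone_nat_of_le_succ (socSeries_le_succ R M)
  obtain ⟨n, hn⟩ := monotone_stabilizes_iff_noetherian.mpr hN
    ⟨fun n => (socSeries R M n).comap (Submodule.span R {x}).subtype,
      fun a b hab => Submodule.comap_mono (hmono hab)⟩
  refine ⟨n, ?_⟩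
  by_contra hx
  have hP : (Submodule.span R {x}).map (socSeries R M n).mkQ ≠ ⊥ := by
    intro h
    apply hx
    have : (socSeries R M n).mkQ x ∈ (Submodule.span R {x}).map (socSeries R M n).mkQ :=
      Submodule.mem_map_of_mem (Submodule.mem_span_singleton_self x)
    rw [h] at this
    simpa using this
  have : IsAtomic (Submodule R (M ⧸ socSeries R M n)) :=
    isAtomic_of_orderBot_wellFounded_lt wellFounded_lt
  obtain ⟨a, ha, hle⟩ := (eq_bot_or_exists_atom_le
    ((Submodule.span R {x}).map (socSeries R M n).mkQ)).resolve_left hP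
  obtain ⟨y, hya, hy0⟩ := (Submodule.ne_bot_iff a).mp ha.1
  obtain ⟨z, hz, rfl⟩ := hle hya
  have hz1 : z ∈ socSeries R M (n + 1) := by
    have h1 : a ≤ socAux R (M ⧸ socSeries R M n) := by
      unfold socAux
      exact le_biSup (fun m => m) (isSimpleModule_iff_isAtom.mpr ha)
    exact h1 hya
  have h2 := hn (n + 1) (Nat.le_succ n)
  have h3 : (⟨z, hz⟩ : Submodule.span R {x}) ∈
      (socSeries R M n).comap (Submodule.span R {x}).subtype := by
    change _ = (socSeries R M (n+1)).comap (Submodule.span R {x}).subtype at h2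
    change _ ∈ _ at hz1
    have h4 : (socSeries R M n).comap (Submodule.span R {x}).subtype =
      (socSeries R M (n+1)).comap (Submodule.span R {x}).subtype := h2
    rw [h4]
    exact hz1
  apply hy0
  have h5 : z ∈ socSeries R M n := h3
  simpa using h5

/-- **Theorem 3 (Anderson).** Let `R` be a commutative ring. Then every Artinian
`R`-module is countably generated: it has a countable generating set. -/
theorem artinian_countably_generated
    (R : Type*) [CommRing R] (M : Type*) [AddCommGroup M] [Module R M]
    [IsArtinian R M] :
    ∃ S : Set M, S.Countable ∧ Submodule.span R S = ⊤ := by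
  choose s hs using fun n => socSeries_fg R M n
  refine ⟨⋃ n, (s n : Set M), Set.countable_iUnion fun n => (s n).countable_toSet, ?_⟩
  rw [eq_top_iff]
  intro x _
  obtain ⟨n, hn⟩ := exists_mem_socSeries R M x
  rw [← hs n] at hn
  exact Submodule.span_mono (Set.subset_iUnion (fun n => (s n : Set M)) n) hn
end

section
/- Let R be a commutative local ring with unique maximal ideal J, and let M be a nontrivial Artinian R-module. If the residue field R/J is finite, then M is countable. -/
theorem finite_of_artinian_of_pow_smul_eq_bot {R : Type*} [CommRing R] (J : Ideal R)
    [J.IsMaximal] [Finite (R ⧸ J)] (n : ℕ) :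
    ∀ {N : Type*} [AddCommGroup N] [Module R N] [IsArtinian R N],
      (J ^ n • (⊤ : Submodule R N) = ⊥) → Finite N := by
  induction n with
  | zero =>
    intro N _ _ _ h
    rw [pow_zero, Ideal.one_eq_top, Submodule.top_smul] at h
    have : Subsingleton N := (Submodule.subsingleton_iff R).mp (subsingleton_of_bot_eq_top h.symm)
    infer_instance
  | succ n ih =>
    intro N _ _ _ h
    have h1 : Finite (J • (⊤ : Submodule R N) : Submodule R N) := by
      apply ih
      apply Submodule.map_injective_of_injective (Submodule.injective_subtype _)
      rw [Submodule.map_smul'', Submodule.map_top, Submodule.range_subtype, Submodule.map_bot,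
        ← mul_smul, ← pow_succ, h]
    have h2 : Finite (N ⧸ (J • (⊤ : Submodule R N))) := by
      letI := Ideal.Quotient.field J
      have : IsScalarTower R (R ⧸ J) (N ⧸ (J • (⊤ : Submodule R N))) :=
        ⟨fun r s x => by
          obtain ⟨s, rfl⟩ := Ideal.Quotient.mk_surjective s

          exact mul_smul r s x⟩
      have hA : IsArtinian (R ⧸ J) (N ⧸ (J • (⊤ : Submodule R N))) :=
        isArtinian_of_tower R inferInstance
      have hF : Module.Finite (R ⧸ J) (N ⧸ (J • (⊤ : Submodule R N))) :=
        (IsSemisimpleModule.finite_tfae.out 0 2).mpr hA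
      exact Module.finite_of_finite (R ⧸ J)
    have := Submodule.card_eq_card_quotient_mul_card (J • (⊤ : Submodule R N))
    apply Nat.finite_of_card_ne_zero
    rw [this]
    exact (Nat.mul_pos Nat.card_pos Nat.card_pos).ne.symm

/-- **Theorem 6(1).** Let `R` be a commutative local ring with unique maximal ideal `J`,
and let `M` be a nontrivial Artinian `R`-module. If the residue field `R/J` is finite,
then `M` is countable. -/
theorem countable_of_artinian_of_finite_residue_field
    (R : Type*) [CommRing R] (J : Ideal R) (hJ : ∀ I : Ideal R, I.IsMaximal ↔ I = J)
    (M : Type*) [AddCommGroup M] [Module R M] [IsArtinian R M] (hM : Nontrivial M)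
    (hfin : Finite (R ⧸ J)) :
    Countable M := by
  have hmax : J.IsMaximal := (hJ J).mpr rfl
  have key : ∀ x : M, ∃ n : ℕ, x ∈ Submodule.torsionBySet R M ((J ^ n : Ideal R) : Set R) := by
    intro x
    let A := Ideal.torsionOf R M x
    have h0 : IsArtinian R (R ⧸ A) :=
      isArtinian_of_linearEquiv (Ideal.quotTorsionOfEquivSpanSingleton R M x).symm
    have h1 : IsArtinianRing (R ⧸ A) := isArtinian_of_tower R h0
    obtain ⟨n, hn⟩ := IsArtinianRing.isNilpotent_jacobson_bot (R := R ⧸ A)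
    refine ⟨n, ?_⟩
    have hle : J.map (Ideal.Quotient.mk A) ≤ Ring.jacobson (R ⧸ A) := by
      rw [← Ideal.jacobson_bot]
      refine le_sInf fun m hm => ?_
      have hmm : m.IsMaximal := hm.2
      rw [Ideal.map_le_iff_le_comap]
      have := Ideal.comap_isMaximal_of_surjective (Ideal.Quotient.mk A)
        Ideal.Quotient.mk_surjective (K := m)
      exact ((hJ _).mp this).ge
    rw [Submodule.mem_torsionBySet_iff]
    rintro ⟨a, ha⟩
    have h2 : Ideal.Quotient.mk A a ∈ (J.map (Ideal.Quotient.mk A)) ^ n := by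
      rw [← Ideal.map_pow]
      exact Ideal.mem_map_of_mem _ ha
    have h3 := Ideal.pow_right_mono hle n h2
    rw [← Ideal.jacobson_bot, hn] at h3
    have h4 : a ∈ A := Ideal.Quotient.eq_zero_iff_mem.mp h3
    exact (Ideal.mem_torsionOf_iff x a).mp h4
  have hf : ∀ n : ℕ, Finite (Submodule.torsionBySet R M ((J ^ n : Ideal R) : Set R)) := by
    intro n
    apply finite_of_artinian_of_pow_smul_eq_bot J n
    rw [eq_bot_iff, Submodule.smul_le]
    rintro r hr ⟨x, hx⟩ -
    rw [Submodule.mem_bot]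
    exact Subtype.ext ((Submodule.mem_torsionBySet_iff _ _).mp hx ⟨r, hr⟩)
  rw [← Set.countable_univ_iff]
  refine (Set.countable_iUnion fun n : ℕ =>
    (Set.toFinite (Submodule.torsionBySet R M ((J ^ n : Ideal R) : Set R) : Set M)).countable).mono
    fun x _ => Set.mem_iUnion.mpr (key x)
end

section
/- Let R be a commutative local ring with unique maximal ideal J, and let M be a nontrivial Artinian R-module. If the residue field R/J is infinite, then the cardinality of M equals the cardinality of R/J. -/
universe u

theorem aux_card_field (K : Type u) [Field K] (hinf : Infinite K) (Q : Type u) [AddCommGroup Q]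
    [Module K Q] [h : IsArtinian K Q] : Cardinal.mk Q ≤ Cardinal.mk K := by
  have : Module.Finite K Q :=
    ((IsSemisimpleModule.finite_tfae (R := K) (M := Q)).out 0 2).mpr h
  obtain ⟨n, f, hf⟩ := Module.Finite.exists_fin' K Q
  refine (Cardinal.mk_le_of_surjective hf).trans ?_
  have := Cardinal.power_nat_le (n := n) (Cardinal.aleph0_le_mk K)
  simpa using this

theorem aux_card_union (M : Type u) (k : Cardinal.{u}) (hk : Cardinal.aleph0 ≤ k)
    (S : ℕ → Set M) (hS : ∀ n, Cardinal.mk (S n) ≤ k) (hc : ∀ x, ∃ n, x ∈ S n) :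
    Cardinal.mk M ≤ k := by
  have hU : (⋃ i : ULift.{u} ℕ, S i.down) = Set.univ :=
    Set.eq_univ_of_forall fun x => Set.mem_iUnion.2 ⟨⟨(hc x).choose⟩, (hc x).choose_spec⟩
  rw [← Cardinal.mk_univ, ← hU]
  refine Cardinal.mk_iUnion_le_sum_mk.trans ?_
  refine (Cardinal.sum_le_sum _ (fun _ => k) (fun i : ULift.{u} ℕ => hS i.down)).trans ?_
  rw [Cardinal.sum_const']
  refine (mul_le_mul' (?_ : _ ≤ k) le_rfl).trans (Cardinal.mul_eq_self hk).le
  simpa using hk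

theorem aux_card_killed (R : Type u) [CommRing R] (J : Ideal R) [J.IsMaximal]
    (hinf : Infinite (R ⧸ J)) (Q : Type u) [AddCommGroup Q] [Module R Q] [IsArtinian R Q]
    (h : ∀ r ∈ J, ∀ q : Q, r • q = 0) : Cardinal.mk Q ≤ Cardinal.mk (R ⧸ J) := by
  have ht : Module.IsTorsionBySet R Q (J : Set R) := fun q r => h r.1 r.2 q
  let : Module (R ⧸ J) Q := ht.module
  have : IsScalarTower R (R ⧸ J) Q := ht.isScalarTower
  let : Field (R ⧸ J) := Ideal.Quotient.field J
  have : IsArtinian (R ⧸ J) Q := isArtinian_of_tower R inferInstance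
  exact aux_card_field (R ⧸ J) hinf Q

theorem aux_card_torsion (R : Type u) [CommRing R] (J : Ideal R) [J.IsMaximal]
    (hinf : Infinite (R ⧸ J)) (M : Type u) [AddCommGroup M] [Module R M] [IsArtinian R M]
    (n : ℕ) : Cardinal.mk (Submodule.torsionBySet R M ((J ^ n : Ideal R) : Set R))
      ≤ Cardinal.mk (R ⧸ J) := by
  induction n with
  | zero =>
    have : Subsingleton (Submodule.torsionBySet R M ((J ^ 0 : Ideal R) : Set R)) := by
      refine ⟨fun a b => Subtype.ext ?_⟩
      have h : ∀ x : Submodule.torsionBySet R M ((J ^ 0 : Ideal R) : Set R), (x : M) = 0 := by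
        intro x
        have := (Submodule.mem_torsionBySet_iff _ _).1 x.2 ⟨1, by simp⟩
        simpa using this
      rw [h a, h b]
    exact (Cardinal.le_one_iff_subsingleton.2 this).trans
      (Cardinal.one_le_aleph0.trans (Cardinal.aleph0_le_mk _))
  | succ n ih =>
    set P := Submodule.torsionBySet R M ((J ^ n : Ideal R) : Set R)
    set P' := Submodule.torsionBySet R M ((J ^ (n+1) : Ideal R) : Set R)
    have hq : Cardinal.mk (P' ⧸ P.submoduleOf P') ≤ Cardinal.mk (R ⧸ J) := by
      apply aux_card_killed R J hinf
      intro r hr q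
      obtain ⟨x, rfl⟩ := Submodule.Quotient.mk_surjective _ q
      rw [← Submodule.Quotient.mk_smul, Submodule.Quotient.mk_eq_zero]
      change r • (x : M) ∈ P
      refine (Submodule.mem_torsionBySet_iff _ _).2 ?_
      rintro ⟨a, ha⟩
      have := (Submodule.mem_torsionBySet_iff _ _).1 x.2
        ⟨a * r, by rw [pow_succ]; exact Ideal.mul_mem_mul ha hr⟩
      simpa [mul_smul] using this
    have hs : Cardinal.mk (P.submoduleOf P') ≤ Cardinal.mk (R ⧸ J) := by
      refine (Cardinal.mk_le_of_injective
        (f := fun x : P.submoduleOf P' => (⟨(x : P').1, x.2⟩ : P)) ?_).trans ih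
      intro x y hxy
      exact Subtype.ext (Subtype.ext (congrArg (fun z : P => (z : M)) hxy))
    have e : P' ≃ (P' ⧸ P.submoduleOf P') × (P.submoduleOf P') :=
      AddSubgroup.addGroupEquivQuotientProdAddSubgroup (s := (P.submoduleOf P').toAddSubgroup)
    rw [Cardinal.mk_congr e, Cardinal.mk_prod, Cardinal.lift_id, Cardinal.lift_id]
    exact (mul_le_mul' hq hs).trans (Cardinal.mul_eq_self (Cardinal.aleph0_le_mk _)).le

theorem aux_mem_torsion (R : Type u) [CommRing R] (J : Ideal R)
    (hJ : ∀ I : Ideal R, I.IsMaximal ↔ I = J)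
    (M : Type u) [AddCommGroup M] [Module R M] [IsArtinian R M] (x : M) :
    ∃ n : ℕ, x ∈ Submodule.torsionBySet R M ((J ^ n : Ideal R) : Set R) := by
  let I : Ideal R := LinearMap.ker (LinearMap.toSpanSingleton R M x)
  have hI : ∀ r, r ∈ I ↔ r • x = 0 := fun r => by simp [I]
  have : IsArtinian R (R ⧸ I) :=
    isArtinian_of_linearEquiv
      (LinearMap.quotKerEquivRange (LinearMap.toSpanSingleton R M x)).symm
  have : IsArtinianRing (R ⧸ I) := isArtinian_of_tower R inferInstance
  obtain ⟨n, hn⟩ := IsArtinianRing.isNilpotent_jacobson_bot (R := R ⧸ I)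
  have hle : J.map (Ideal.Quotient.mk I) ≤ Ideal.jacobson ⊥ := by
    rw [Ideal.map_le_iff_le_comap]
    intro r hr
    rw [Ideal.mem_comap, Ideal.mem_jacobson_bot]
    intro y
    obtain ⟨s, rfl⟩ := Ideal.Quotient.mk_surjective y
    have hu : IsUnit (r * s + 1) := by
      by_contra hu
      obtain ⟨m, hm, hmem⟩ := exists_max_ideal_of_mem_nonunits hu
      obtain rfl := (hJ m).1 hm
      exact hm.ne_top ((Ideal.eq_top_iff_one _).2
        ((Ideal.add_mem_iff_right _ (Ideal.mul_mem_right s _ hr)).1 hmem))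
    simpa using hu.map (Ideal.Quotient.mk I)
  refine ⟨n, (Submodule.mem_torsionBySet_iff _ _).2 ?_⟩
  rintro ⟨a, ha⟩
  have h1 : Ideal.Quotient.mk I a ∈ (J.map (Ideal.Quotient.mk I)) ^ n := by
    rw [← Ideal.map_pow]; exact Ideal.mem_map_of_mem _ ha
  have h2 := Ideal.pow_right_mono hle n h1
  rw [hn] at h2
  exact (hI a).1 (Ideal.Quotient.eq_zero_iff_mem.1 (by simpa using h2))

/-- **Theorem 6(2).** Let `R` be a commutative local ring with unique maximal ideal `J`,
and let `M` be a nontrivial Artinian `R`-module. If the residue field `R/J` is infinite,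
then `|M| = |R/J|`. -/
theorem card_eq_card_residue_field_of_artinian_of_infinite_residue_field
    (R : Type u) [CommRing R] (J : Ideal R) (hJ : ∀ I : Ideal R, I.IsMaximal ↔ I = J)
    (M : Type u) [AddCommGroup M] [Module R M] [IsArtinian R M] (hM : Nontrivial M)
    (hinf : Infinite (R ⧸ J)) :
    Cardinal.mk M = Cardinal.mk (R ⧸ J) := by
  have : J.IsMaximal := (hJ J).2 rfl
  have hk := Cardinal.aleph0_le_mk (R ⧸ J)
  apply le_antisymm
  · exact aux_card_union M _ hk
      (fun n => (Submodule.torsionBySet R M ((J ^ n : Ideal R) : Set R) : Set M))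
      (aux_card_torsion R J hinf M) (aux_mem_torsion R J hJ M)
  · obtain ⟨x, hx⟩ := exists_ne (0 : M)
    let I : Ideal R := LinearMap.ker (LinearMap.toSpanSingleton R M x)
    have hI : I ≠ ⊤ := by
      intro h
      have : (1 : R) ∈ I := h ▸ Submodule.mem_top
      exact hx (by simpa [I] using this)
    obtain ⟨m, hm, hIm⟩ := Ideal.exists_le_maximal I hI
    obtain rfl := (hJ m).1 hm
    refine (Cardinal.mk_le_of_surjective (Ideal.Quotient.factor_surjective hIm)).trans ?_
    refine (Cardinal.mk_congr (LinearMap.quotKerEquivRange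
      (LinearMap.toSpanSingleton R M x)).toEquiv).le.trans ?_
    exact Cardinal.mk_le_of_injective Subtype.val_injective
end
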